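/- There exist universal constants C and D₀ such that for every finite set Ē₀ ⊂ ℝ there is a family of maps {Ξ₊ᵗ : t ∈ ℝ}, where each Ξ₊ᵗ maps C²₊(Ē₀) into the space of single-variable real polynomials of degree at most 2, satisfying: (A) for each t ∈ ℝ there is a set S̄(t) ⊆ Ē₀ with #S̄(t) ≤ D₀ such that Ξ₊ᵗ(f) depends only on f|_{S̄(t)}; (B) for every f ∈ C²₊(Ē₀) there exists F ∈ C²(ℝ) with F ≥ 0 on ℝ, such that the degree-2 Taylor polynomial of F at t equals Ξ₊ᵗ(f) for every t ∈ ℝ, ‖F‖_{C²(ℝ)} ≤ C·‖f‖_{C²₊(Ē₀)}, and F(t) = f(t) for all t ∈ Ē₀. -/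

import Mathlib

/-- `F : ℝ → ℝ` is twice continuously differentiable with `|F|, |F'|, |F''|`
bounded by `M`; this encodes `‖F‖_{C²(ℝ)} ≤ M`. -/
def C2BddBy1 (F : ℝ → ℝ) (M : ℝ) : Prop :=
  ContDiff ℝ 2 F ∧ ∀ t : ℝ, |F t| ≤ M ∧ |deriv F t| ≤ M ∧ |deriv (deriv F) t| ≤ M

/-- The one-dimensional nonnegative trace norm `‖f‖_{C²₊(Ē₀)}`. -/
noncomputable def posTraceNorm1 (E : Set ℝ) (f : ℝ → ℝ) : ℝ :=
  sInf {M : ℝ | 0 ≤ M ∧ ∃ F : ℝ → ℝ,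
    (∀ t, 0 ≤ F t) ∧ (∀ t ∈ E, F t = f t) ∧ C2BddBy1 F M}

section C2Basics

theorem contDiff_two_of_hasDerivAt {F F₁ F₂ : ℝ → ℝ} (h₁ : ∀ t, HasDerivAt F (F₁ t) t)
    (h₂ : ∀ t, HasDerivAt F₁ (F₂ t) t) (hc : Continuous F₂) : ContDiff ℝ 2 F := by
  have e₁ : deriv F = F₁ := funext fun t => (h₁ t).deriv
  have e₂ : deriv F₁ = F₂ := funext fun t => (h₂ t).deriv
  have c₁ : ContDiff ℝ 1 F₁ :=
    contDiff_one_iff_deriv.2 ⟨fun t => (h₂ t).differentiableAt, e₂ ▸ hc⟩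
  rw [show (2 : WithTop ℕ∞) = 1 + 1 by norm_num, contDiff_succ_iff_deriv]
  exact ⟨fun t => (h₁ t).differentiableAt, by simp, e₁ ▸ c₁⟩

variable {G : ℝ → ℝ} {M : ℝ}

theorem C2BddBy1.differentiable (hG : C2BddBy1 G M) : Differentiable ℝ G :=
  hG.1.differentiable (by norm_num)

theorem C2BddBy1.differentiable_deriv (hG : C2BddBy1 G M) : Differentiable ℝ (deriv G) := by
  have h := hG.1
  rw [show (2 : WithTop ℕ∞) = 1 + 1 by norm_num, contDiff_succ_iff_deriv] at h
  exact h.2.2.differentiable (by norm_num)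

theorem C2BddBy1.abs_deriv_sub_le (hG : C2BddBy1 G M) (x y : ℝ) :
    |deriv G y - deriv G x| ≤ M * |y - x| := by
  have := Convex.norm_image_sub_le_of_norm_deriv_le (s := Set.univ) (f := deriv G) (C := M)
    (fun z _ => hG.differentiable_deriv z) (fun z _ => (hG.2 z).2.2) convex_univ
    (Set.mem_univ x) (Set.mem_univ y)
  simpa using this

theorem C2BddBy1.abs_sub_taylor_le (hG : C2BddBy1 G M) (x y : ℝ) :
    |G y - G x - deriv G x * (y - x)| ≤ M * (y - x) ^ 2 := by
  have hM : 0 ≤ M := (abs_nonneg _).trans (hG.2 0).1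
  have hd : ∀ z, HasDerivAt (fun z => G z - deriv G x * z) (deriv G z - deriv G x) z := fun z => by
    simpa using (hG.differentiable z).hasDerivAt.fun_sub ((hasDerivAt_id z).const_mul (deriv G x))
  have := Convex.norm_image_sub_le_of_norm_hasDerivWithin_le (s := Set.uIcc x y)
    (f := fun z => G z - deriv G x * z) (C := M * |y - x|)
    (fun z _ => (hd z).hasDerivWithinAt)
    (fun z hz => (hG.abs_deriv_sub_le x z).trans
      (mul_le_mul_of_nonneg_left (Set.abs_sub_left_of_mem_uIcc hz) hM))
    (convex_uIcc x y) Set.left_mem_uIcc Set.right_mem_uIcc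
  simp only [Real.norm_eq_abs] at this
  calc |G y - G x - deriv G x * (y - x)|
      = |G y - deriv G x * y - (G x - deriv G x * x)| := by congr 1; ring
    _ ≤ M * |y - x| * |y - x| := this
    _ = M * (y - x) ^ 2 := by rw [mul_assoc, ← sq, sq_abs]

theorem C2BddBy1.sq_deriv_le (hG : C2BddBy1 G M) (h0 : ∀ t, 0 ≤ G t) (x : ℝ) :
    deriv G x ^ 2 ≤ 4 * M * G x := by
  have h : ∀ z : ℝ, 0 ≤ M * (z * z) + deriv G x * z + G x := fun z => by
    have h₁ := (abs_le.1 (hG.abs_sub_taylor_le x (x + z))).2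
    have h₂ := h0 (x + z)
    rw [add_sub_cancel_left] at h₁
    nlinarith
  have := discrim_le_zero h
  unfold discrim at this
  linarith

end C2Basics

section Step

/-- A `C²` step function with its first two derivatives. -/
structure IsStep (s₀ s₁ s₂ : ℝ → ℝ) (K : ℝ) : Prop where
  deriv₀ : ∀ u, HasDerivAt s₀ (s₁ u) u
  deriv₁ : ∀ u, HasDerivAt s₁ (s₂ u) u
  cont₂ : Continuous s₂
  left : ∀ u ≤ 0, s₀ u = 0 ∧ s₁ u = 0 ∧ s₂ u = 0
  right : ∀ u, 1 ≤ u → s₀ u = 1 ∧ s₁ u = 0 ∧ s₂ u = 0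
  nonneg : ∀ u, 0 ≤ s₀ u
  le_one : ∀ u, s₀ u ≤ 1
  bound₁ : ∀ u, |s₁ u| ≤ K
  bound₂ : ∀ u, |s₂ u| ≤ K
  one_le : 1 ≤ K
  symm₀ : ∀ u, s₀ (1 - u) = 1 - s₀ u
  symm₁ : ∀ u, s₁ (1 - u) = s₁ u
  symm₂ : ∀ u, s₂ (1 - u) = -s₂ u

theorem deriv_eq_zero_of_eqOn_const {g : ℝ → ℝ} {c : ℝ} {U : Set ℝ} (hU : IsOpen U)
    (hg : ∀ u ∈ U, g u = c) (hc : Continuous (deriv g)) : ∀ u ∈ closure U, deriv g u = 0 := by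
  have hcl : IsClosed {u | deriv g u = 0} := isClosed_eq hc continuous_const
  refine fun u hu => closure_minimal (fun v hv => ?_) hcl hu
  have : g =ᶠ[nhds v] fun _ => c := Filter.eventuallyEq_of_mem (hU.mem_nhds hv) hg
  simpa using this.deriv_eq

theorem exists_bound_of_eq_zero_off_Icc {g : ℝ → ℝ} (hc : Continuous g)
    (hl : ∀ u ≤ 0, g u = 0) (hr : ∀ u, 1 ≤ u → g u = 0) : ∃ K, ∀ u, |g u| ≤ K := by
  have hs : HasCompactSupport g := HasCompactSupport.intro (isCompact_Icc (a := (0 : ℝ)) (b := 1))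
    fun u hu => by
      by_cases h : u ≤ 0
      · exact hl u h
      · exact hr u (by by_contra h'; exact hu ⟨by linarith, by linarith⟩)
  exact hc.bounded_above_of_compact_support hs

theorem exists_isStep : ∃ s₀ s₁ s₂ K, IsStep s₀ s₁ s₂ K := by
  set s := Real.smoothTransition
  have hs : ContDiff ℝ 2 s := Real.smoothTransition.contDiff
  have hs' := hs
  rw [show (2 : WithTop ℕ∞) = 1 + 1 by norm_num, contDiff_succ_iff_deriv] at hs'
  obtain ⟨d₀, -, h₁⟩ := hs'
  obtain ⟨d₁, c₂⟩ := contDiff_one_iff_deriv.1 h₁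
  have c₁ := d₁.continuous
  have l₁ : ∀ u ≤ 0, deriv s u = 0 := fun u hu =>
    deriv_eq_zero_of_eqOn_const (c := 0) isOpen_Iio
      (fun v hv => Real.smoothTransition.zero_of_nonpos (le_of_lt hv)) c₁ u
      (by rw [closure_Iio]; exact hu)
  have r₁ : ∀ u, 1 ≤ u → deriv s u = 0 := fun u hu =>
    deriv_eq_zero_of_eqOn_const (c := 1) isOpen_Ioi
      (fun v hv => Real.smoothTransition.one_of_one_le (le_of_lt hv)) c₁ u
      (by rw [closure_Ioi]; exact hu)
  have l₂ : ∀ u ≤ 0, deriv (deriv s) u = 0 := fun u hu =>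
    deriv_eq_zero_of_eqOn_const (c := 0) isOpen_Iio
      (fun v hv => l₁ v (le_of_lt hv)) c₂ u (by rw [closure_Iio]; exact hu)
  have r₂ : ∀ u, 1 ≤ u → deriv (deriv s) u = 0 := fun u hu =>
    deriv_eq_zero_of_eqOn_const (c := 0) isOpen_Ioi
      (fun v hv => r₁ v (le_of_lt hv)) c₂ u (by rw [closure_Ioi]; exact hu)
  obtain ⟨K₁, hK₁⟩ := exists_bound_of_eq_zero_off_Icc c₁ l₁ r₁
  obtain ⟨K₂, hK₂⟩ := exists_bound_of_eq_zero_off_Icc c₂ l₂ r₂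
  have y₀ : ∀ u, s (1 - u) = 1 - s u := fun u => by
    have hp := Real.smoothTransition.pos_denom u
    simp only [s, Real.smoothTransition, sub_sub_cancel]
    rw [add_comm (expNegInvGlue (1 - u))]
    field_simp
    ring
  have y₁ : ∀ u, deriv s (1 - u) = deriv s u := fun u => by
    have h := deriv_comp_const_sub (f := s) (1 : ℝ) u
    rw [show (fun x => s (1 - x)) = fun x => 1 - s x from funext y₀, deriv_const_sub] at h
    linarith
  have y₂ : ∀ u, deriv (deriv s) (1 - u) = -deriv (deriv s) u := fun u => by
    have h := deriv_comp_const_sub (f := deriv s) (1 : ℝ) u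
    rw [show (fun x => deriv s (1 - x)) = deriv s from funext y₁] at h
    linarith
  exact ⟨s, deriv s, deriv (deriv s), max 1 (max K₁ K₂),
    { deriv₀ := fun u => (d₀ u).hasDerivAt
      deriv₁ := fun u => (d₁ u).hasDerivAt
      cont₂ := c₂
      left := fun u hu => ⟨Real.smoothTransition.zero_of_nonpos hu, l₁ u hu, l₂ u hu⟩
      right := fun u hu => ⟨Real.smoothTransition.one_of_one_le hu, r₁ u hu, r₂ u hu⟩
      nonneg := Real.smoothTransition.nonneg
      le_one := Real.smoothTransition.le_one
      bound₁ := fun u => (hK₁ u).trans (by simp)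
      bound₂ := fun u => (hK₂ u).trans (by simp)
      one_le := le_max_left _ _
      symm₀ := y₀
      symm₁ := y₁
      symm₂ := y₂ }⟩

end Step

section Neighbors

/-- `L y` and `R y` are the neighbours of `y` in `E`, truncated at distance one. -/
structure IsNeighbors (E : Finset ℝ) (L R : ℝ → ℝ) : Prop where
  lt_right : ∀ y, y < R y
  right_le : ∀ y, R y ≤ y + 1
  right_le_of_mem : ∀ y, ∀ e ∈ E, y < e → R y ≤ e
  right_mem : ∀ y, R y ∈ E ∨ R y = y + 1
  left_lt : ∀ y, L y < y
  le_left : ∀ y, y - 1 ≤ L y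
  le_left_of_mem : ∀ y, ∀ e ∈ E, e < y → e ≤ L y
  left_mem : ∀ y, L y ∈ E ∨ L y = y - 1

theorem exists_isNeighbors (E : Finset ℝ) : ∃ L R, IsNeighbors E L R := by
  have hr : ∀ y : ℝ, ∃ r, y < r ∧ r ≤ y + 1 ∧ (∀ e ∈ E, y < e → r ≤ e) ∧ (r ∈ E ∨ r = y + 1) := by
    intro y
    obtain ⟨r, hr, hmin⟩ := Finset.exists_min_image (insert (y + 1) (E.filter (y < ·))) id
      (Finset.insert_nonempty _ _)
    simp only [Finset.mem_insert, Finset.mem_filter, id] at hr hmin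
    refine ⟨r, ?_, hmin _ (Or.inl rfl), fun e he hy => hmin e (Or.inr ⟨he, hy⟩), ?_⟩
    · rcases hr with rfl | hr
      · linarith
      · exact hr.2
    · tauto
  have hl : ∀ y : ℝ, ∃ r, r < y ∧ y - 1 ≤ r ∧ (∀ e ∈ E, e < y → e ≤ r) ∧ (r ∈ E ∨ r = y - 1) := by
    intro y
    obtain ⟨r, hr, hmin⟩ := Finset.exists_max_image (insert (y - 1) (E.filter (· < y))) id
      (Finset.insert_nonempty _ _)
    simp only [Finset.mem_insert, Finset.mem_filter, id] at hr hmin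
    refine ⟨r, ?_, hmin _ (Or.inl rfl), fun e he hy => hmin e (Or.inr ⟨he, hy⟩), ?_⟩
    · rcases hr with rfl | hr
      · linarith
      · exact hr.2
    · tauto
  choose R h₁ h₂ h₃ h₄ using hr
  choose L h₅ h₆ h₇ h₈ using hl
  exact ⟨L, R, h₁, h₂, h₃, h₄, h₅, h₆, h₇, h₈⟩

/-- `n y` is a nearest point to `y` in `E \ {y}`, when there is one. -/
def IsNearest (E : Finset ℝ) (n : ℝ → ℝ) : Prop :=
  ∀ y ∈ E, n y ∈ E ∧ ∀ e ∈ E, e ≠ y → n y ≠ y ∧ |n y - y| ≤ |e - y|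

theorem exists_isNearest (E : Finset ℝ) : ∃ n, IsNearest E n := by
  have : ∀ y : ℝ, ∃ z, y ∈ E → z ∈ E ∧ ∀ e ∈ E, e ≠ y → z ≠ y ∧ |z - y| ≤ |e - y| := by
    intro y
    rcases (E.erase y).eq_empty_or_nonempty with h | h
    · refine ⟨y, fun hy => ⟨hy, fun e he hne => ?_⟩⟩
      have : e ∈ E.erase y := Finset.mem_erase.2 ⟨hne, he⟩
      simp [h] at this
    · obtain ⟨z, hz, hmin⟩ := Finset.exists_min_image (E.erase y) (fun e => |e - y|) h
      rw [Finset.mem_erase] at hz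
      exact ⟨z, fun _ => ⟨hz.2, fun e he hne => ⟨hz.1, hmin e (Finset.mem_erase.2 ⟨hne, he⟩)⟩⟩⟩
  choose n hn using this
  exact ⟨n, fun y hy => hn y hy⟩

variable {E : Finset ℝ} {L R : ℝ → ℝ}

theorem IsNeighbors.left_right (h : IsNeighbors E L R) {y : ℝ} (hy : y ∈ E) :
    L (R y) = y := by
  refine le_antisymm ?_ (h.le_left_of_mem _ _ hy (h.lt_right y))
  rcases h.left_mem (R y) with hL | hL
  · by_contra! hlt
    exact absurd (h.right_le_of_mem y _ hL hlt) (not_le.2 (h.left_lt _))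
  · linarith [h.right_le y]

theorem IsNeighbors.right_left (h : IsNeighbors E L R) {y : ℝ} (hy : y ∈ E) :
    R (L y) = y := by
  refine le_antisymm (h.right_le_of_mem _ _ hy (h.left_lt y)) ?_
  rcases h.right_mem (L y) with hR | hR
  · by_contra! hlt
    exact absurd (h.le_left_of_mem y _ hR hlt) (not_le.2 (h.lt_right _))
  · linarith [h.le_left y]

open scoped Classical in
/-- The points of `E` whose cell contains `t`. -/
noncomputable def activePoints (E : Finset ℝ) (L R : ℝ → ℝ) (t : ℝ) : Finset ℝ :=
  E.filter fun y => L y < t ∧ t < R y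

theorem mem_activePoints {t y : ℝ} :
    y ∈ activePoints E L R t ↔ y ∈ E ∧ L y < t ∧ t < R y := by
  classical
  simp [activePoints]

theorem IsNeighbors.card_activePoints_le (h : IsNeighbors E L R) (t : ℝ) :
    (activePoints E L R t).card ≤ 2 := by
  classical
  rw [← Finset.card_filter_add_card_filter_not (s := activePoints E L R t) (p := fun y => y < t)]
  have h₁ : ((activePoints E L R t).filter (fun y => y < t)).card ≤ 1 := by
    refine Finset.card_le_one.2 fun a ha b hb => ?_
    simp only [Finset.mem_filter, mem_activePoints] at ha hb
    rcases lt_trichotomy a b with hab | hab | hab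
    · linarith [h.right_le_of_mem a b hb.1.1 hab]
    · exact hab
    · linarith [h.right_le_of_mem b a ha.1.1 hab]
  have h₂ : ((activePoints E L R t).filter (fun y => ¬ y < t)).card ≤ 1 := by
    refine Finset.card_le_one.2 fun a ha b hb => ?_
    simp only [Finset.mem_filter, mem_activePoints] at ha hb
    rcases lt_trichotomy a b with hab | hab | hab
    · linarith [h.le_left_of_mem b a ha.1.1 hab]
    · exact hab
    · linarith [h.le_left_of_mem a b hb.1.1 hab]
  omega

theorem IsNeighbors.activePoints_subset_pair (h : IsNeighbors E L R) {a b t : ℝ} (ha : a ∈ E)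
    (hb : b ∈ E) (hat : a < t) (htb : t < b) (hR : R a = b) :
    activePoints E L R t ⊆ {a, b} := by
  intro y hy
  rw [mem_activePoints] at hy
  rw [Finset.mem_insert, Finset.mem_singleton]
  rcases lt_trichotomy y a with hya | hya | hya
  · linarith [h.right_le_of_mem y a ha hya]
  · exact Or.inl hya
  · have := h.right_le_of_mem a y hy.1 hya
    rw [hR] at this
    rcases this.eq_or_lt with hyb | hyb
    · exact Or.inr hyb.symm
    · linarith [h.le_left_of_mem y b hb hyb]

end Neighbors

section Weights

/-- The product of a rising step on `[l, y]` and a falling step on `[y, r]`. -/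
noncomputable def cell₀ (s₀ : ℝ → ℝ) (l y r t : ℝ) : ℝ :=
  s₀ ((t - l) / (y - l)) * s₀ ((r - t) / (r - y))

/-- The first derivative of `cell₀`. -/
noncomputable def cell₁ (s₀ s₁ : ℝ → ℝ) (l y r t : ℝ) : ℝ :=
  s₁ ((t - l) / (y - l)) / (y - l) * s₀ ((r - t) / (r - y)) -
    s₀ ((t - l) / (y - l)) * (s₁ ((r - t) / (r - y)) / (r - y))

/-- The second derivative of `cell₀`. -/
noncomputable def cell₂ (s₀ s₁ s₂ : ℝ → ℝ) (l y r t : ℝ) : ℝ :=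
  s₂ ((t - l) / (y - l)) / (y - l) ^ 2 * s₀ ((r - t) / (r - y)) -
    2 * (s₁ ((t - l) / (y - l)) / (y - l) * (s₁ ((r - t) / (r - y)) / (r - y))) +
    s₀ ((t - l) / (y - l)) * (s₂ ((r - t) / (r - y)) / (r - y) ^ 2)

variable {s₀ s₁ s₂ : ℝ → ℝ} {K : ℝ} {l y r t : ℝ}

theorem HasDerivAt.comp_rise {g : ℝ → ℝ} {g' : ℝ} (hg : HasDerivAt g g' ((t - l) / (y - l))) :
    HasDerivAt (fun t => g ((t - l) / (y - l))) (g' / (y - l)) t := by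
  have := hg.comp t (((hasDerivAt_id t).sub_const l).div_const (y - l))
  simpa [Function.comp_def, div_eq_mul_inv] using this

theorem HasDerivAt.comp_fall {g : ℝ → ℝ} {g' : ℝ} (hg : HasDerivAt g g' ((r - t) / (r - y))) :
    HasDerivAt (fun t => g ((r - t) / (r - y))) (-(g' / (r - y))) t := by
  have := hg.comp t (((hasDerivAt_id t).const_sub r).div_const (r - y))
  simpa [Function.comp_def, div_eq_mul_inv] using this

theorem IsStep.hasDerivAt_cell₀ (h : IsStep s₀ s₁ s₂ K) :
    HasDerivAt (cell₀ s₀ l y r) (cell₁ s₀ s₁ l y r t) t := by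
  refine ((h.deriv₀ _).comp_rise.mul (h.deriv₀ _).comp_fall).congr_deriv ?_
  unfold cell₁
  ring

theorem IsStep.hasDerivAt_cell₁ (h : IsStep s₀ s₁ s₂ K) :
    HasDerivAt (cell₁ s₀ s₁ l y r) (cell₂ s₀ s₁ s₂ l y r t) t := by
  refine ((((h.deriv₁ _).comp_rise.div_const (y - l)).mul (h.deriv₀ _).comp_fall).sub
    ((h.deriv₀ _).comp_rise.mul ((h.deriv₁ _).comp_fall.div_const (r - y)))).congr_deriv ?_
  unfold cell₂
  simp only [div_eq_mul_inv, ← inv_pow]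
  ring

theorem IsStep.continuous_cell₂ (h : IsStep s₀ s₁ s₂ K) :
    Continuous (cell₂ s₀ s₁ s₂ l y r) := by
  have c₀ : Continuous s₀ := continuous_iff_continuousAt.2 fun u => (h.deriv₀ u).continuousAt
  have c₁ : Continuous s₁ := continuous_iff_continuousAt.2 fun u => (h.deriv₁ u).continuousAt
  have c₂ := h.cont₂
  unfold cell₂
  fun_prop

theorem IsStep.cell_eq_zero (h : IsStep s₀ s₁ s₂ K) (hl : l < y) (hr : y < r)
    (ht : ¬ (l < t ∧ t < r)) :
    cell₀ s₀ l y r t = 0 ∧ cell₁ s₀ s₁ l y r t = 0 ∧ cell₂ s₀ s₁ s₂ l y r t = 0 := by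
  have key : (t - l) / (y - l) ≤ 0 ∨ (r - t) / (r - y) ≤ 0 := by
    by_cases hlt : l < t
    · exact Or.inr (div_nonpos_of_nonpos_of_nonneg
        (by linarith [not_lt.1 fun h' => ht ⟨hlt, h'⟩]) (by linarith))
    · exact Or.inl (div_nonpos_of_nonpos_of_nonneg (by linarith) (by linarith))
  unfold cell₀ cell₁ cell₂
  rcases key with hk | hk <;> obtain ⟨e₀, e₁, e₂⟩ := h.left _ hk <;> simp [e₀, e₁, e₂]

theorem IsStep.cell_of_ge (h : IsStep s₀ s₁ s₂ K) (hl : l < y) (ht : y ≤ t) :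
    cell₀ s₀ l y r t = s₀ ((r - t) / (r - y)) ∧
    cell₁ s₀ s₁ l y r t = -(s₁ ((r - t) / (r - y)) / (r - y)) ∧
    cell₂ s₀ s₁ s₂ l y r t = s₂ ((r - t) / (r - y)) / (r - y) ^ 2 := by
  have key : 1 ≤ (t - l) / (y - l) := by rw [le_div_iff₀] <;> linarith
  obtain ⟨e₀, e₁, e₂⟩ := h.right _ key
  unfold cell₀ cell₁ cell₂
  simp [e₀, e₁, e₂]

theorem IsStep.cell_of_le (h : IsStep s₀ s₁ s₂ K) (hr : y < r) (ht : t ≤ y) :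
    cell₀ s₀ l y r t = s₀ ((t - l) / (y - l)) ∧
    cell₁ s₀ s₁ l y r t = s₁ ((t - l) / (y - l)) / (y - l) ∧
    cell₂ s₀ s₁ s₂ l y r t = s₂ ((t - l) / (y - l)) / (y - l) ^ 2 := by
  have key : 1 ≤ (r - t) / (r - y) := by rw [le_div_iff₀] <;> linarith
  obtain ⟨e₀, e₁, e₂⟩ := h.right _ key
  unfold cell₀ cell₁ cell₂
  simp [e₀, e₁, e₂]

theorem IsStep.cell_self (h : IsStep s₀ s₁ s₂ K) (hl : l < y) (hr : y < r) :
    cell₀ s₀ l y r y = 1 ∧ cell₁ s₀ s₁ l y r y = 0 ∧ cell₂ s₀ s₁ s₂ l y r y = 0 := by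
  obtain ⟨e₀, e₁, e₂⟩ := h.cell_of_ge (r := r) hl le_rfl
  obtain ⟨f₀, f₁, f₂⟩ := h.right ((r - y) / (r - y)) (div_self (sub_pos.2 hr).ne').ge
  simp [e₀, e₁, e₂, f₀, f₁, f₂]

theorem IsStep.cell₀_nonneg (h : IsStep s₀ s₁ s₂ K) : 0 ≤ cell₀ s₀ l y r t :=
  mul_nonneg (h.nonneg _) (h.nonneg _)

/-- Away from pairs of close neighbours, all active cells vary at unit scale. -/
theorem IsStep.abs_cell_le (h : IsStep s₀ s₁ s₂ K) {E : Finset ℝ} {L R : ℝ → ℝ}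
    (hE : IsNeighbors E L R)
    (hp : ¬ ∃ a ∈ E, ∃ b ∈ E, a < t ∧ t < b ∧ R a = b ∧ L b = a)
    (hy : y ∈ activePoints E L R t) :
    |cell₀ s₀ (L y) y (R y) t| ≤ K ∧ |cell₁ s₀ s₁ (L y) y (R y) t| ≤ K ∧
      |cell₂ s₀ s₁ s₂ (L y) y (R y) t| ≤ K := by
  have hK := h.one_le
  have b₀ : ∀ u, |s₀ u| ≤ K := fun u =>
    abs_le.2 ⟨by linarith [h.nonneg u], (h.le_one u).trans hK⟩
  obtain ⟨hyE, hLt, htR⟩ := mem_activePoints.1 hy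
  rcases lt_trichotomy y t with hyt | rfl | hyt
  · rcases hE.right_mem y with hR | hR
    · exact absurd ⟨y, hyE, R y, hR, hyt, htR, rfl, hE.left_right hyE⟩ hp
    · obtain ⟨e₀, e₁, e₂⟩ := h.cell_of_ge (r := R y) (hE.left_lt y) hyt.le
      rw [e₀, e₁, e₂, hR]
      simpa using ⟨b₀ _, h.bound₁ _, h.bound₂ _⟩
  · obtain ⟨e₀, e₁, e₂⟩ := h.cell_self (hE.left_lt y) (hE.lt_right y)
    rw [e₀, e₁, e₂]
    simp only [abs_one, abs_zero]
    exact ⟨hK, by linarith, by linarith⟩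
  · rcases hE.left_mem y with hL | hL
    · exact absurd ⟨L y, hL, y, hyE, hLt, hyt, hE.right_left hyE, rfl⟩ hp
    · obtain ⟨e₀, e₁, e₂⟩ := h.cell_of_le (l := L y) (hE.lt_right y) hyt.le
      rw [e₀, e₁, e₂, hL]
      simpa using ⟨b₀ _, h.bound₁ _, h.bound₂ _⟩

end Weights

section NodePolynomials

/-- The slope at `y`, computed from the values at `y` and at its nearest neighbour `n y`. -/
noncomputable def nodeSlope (n f : ℝ → ℝ) (y : ℝ) : ℝ :=
  open scoped Classical in
  if |f (n y) - f y| ≤ f y then (f (n y) - f y) / (n y - y) else 0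

/-- The quadratic coefficient making the node polynomial a perfect square. -/
noncomputable def nodeCurv (n f : ℝ → ℝ) (y : ℝ) : ℝ :=
  nodeSlope n f y ^ 2 / (4 * f y)

/-- The nonnegative quadratic polynomial attached to the node `y`. -/
noncomputable def nodePoly (n f : ℝ → ℝ) (y t : ℝ) : ℝ :=
  f y + nodeSlope n f y * (t - y) + nodeCurv n f y * (t - y) ^ 2

/-- The derivative of `nodePoly`. -/
noncomputable def nodePolyDeriv (n f : ℝ → ℝ) (y t : ℝ) : ℝ :=
  nodeSlope n f y + 2 * nodeCurv n f y * (t - y)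

variable {n f : ℝ → ℝ} {y t : ℝ}

theorem nodeCurv_congr {g : ℝ → ℝ} (h₁ : f y = g y) (h₂ : f (n y) = g (n y)) :
    nodeSlope n f y = nodeSlope n g y ∧ nodeCurv n f y = nodeCurv n g y := by
  have : nodeSlope n f y = nodeSlope n g y := by simp only [nodeSlope, h₁, h₂]
  exact ⟨this, by simp only [nodeCurv, this, h₁]⟩

theorem hasDerivAt_nodePoly : HasDerivAt (nodePoly n f y) (nodePolyDeriv n f y t) t := by
  have h := (hasDerivAt_id t).sub_const y
  refine (((h.const_mul (nodeSlope n f y)).const_add (f y)).add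
    ((h.pow 2).const_mul (nodeCurv n f y))).congr_deriv ?_
  simp [nodePolyDeriv]
  ring

theorem hasDerivAt_nodePolyDeriv :
    HasDerivAt (nodePolyDeriv n f y) (2 * nodeCurv n f y) t := by
  have h := (hasDerivAt_id t).sub_const y
  refine ((h.const_mul (2 * nodeCurv n f y)).const_add (nodeSlope n f y)).congr_deriv ?_
  simp

theorem nodePoly_nonneg (hf : 0 ≤ f y) : 0 ≤ nodePoly n f y t := by
  rcases hf.eq_or_lt with h0 | h0
  · have hm : nodeSlope n f y = 0 := by
      unfold nodeSlope
      split_ifs with h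
      · rw [← h0] at h ⊢
        simp [abs_nonpos_iff.1 h]
      · rfl
    simp [nodePoly, nodeCurv, hm, hf]
  · have : nodePoly n f y t = (2 * f y + nodeSlope n f y * (t - y)) ^ 2 / (4 * f y) := by
      unfold nodePoly nodeCurv
      field_simp
      ring
    rw [this]
    positivity

variable {G : ℝ → ℝ} {M : ℝ}

theorem C2BddBy1.abs_nodeSlope_sub_le (hG : C2BddBy1 G M) (h0 : ∀ t, 0 ≤ G t)
    (hy : G y = f y) (hn : G (n y) = f (n y)) (hne : n y ≠ y) :
    |nodeSlope n f y - deriv G y| ≤ 5 * (M * |n y - y|) := by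
  have hM : 0 ≤ M := (abs_nonneg _).trans (hG.2 0).1
  have hd : 0 < |n y - y| := abs_pos.2 (sub_ne_zero.2 hne)
  have hw : 0 ≤ M * |n y - y| := by positivity
  have ht := hG.abs_sub_taylor_le y (n y)
  rw [hn, hy] at ht
  unfold nodeSlope
  split_ifs with h
  · have : |(f (n y) - f y) / (n y - y) - deriv G y| * |n y - y| ≤ M * |n y - y| * |n y - y| := by
      rw [← abs_mul, sub_mul, div_mul_cancel₀ _ (sub_ne_zero.2 hne), mul_assoc, ← sq, sq_abs]
      exact ht
    linarith [le_of_mul_le_mul_right this hd]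
  · have hs := hG.sq_deriv_le h0 y
    rw [hy] at hs
    rw [← sq_abs (n y - y)] at ht
    rw [← sq_abs (deriv G y)] at hs
    rw [zero_sub, abs_neg]
    have h₁ : |f (n y) - f y| ≤ |deriv G y| * |n y - y| + M * |n y - y| ^ 2 := by
      rw [← abs_mul]
      calc |f (n y) - f y|
          = |(f (n y) - f y - deriv G y * (n y - y)) + deriv G y * (n y - y)| := by
            rw [sub_add_cancel]
        _ ≤ _ := (abs_add_le _ _).trans (by linarith)
    have h₂ : |deriv G y| ^ 2 ≤ 4 * (M * |n y - y|) * |deriv G y| + 4 * (M * |n y - y|) ^ 2 := by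
      have := mul_le_mul_of_nonneg_left ((not_le.1 h).le.trans h₁) hM
      nlinarith
    by_contra! hc
    nlinarith [abs_nonneg (deriv G y)]

theorem C2BddBy1.sq_nodeSlope_le (hG : C2BddBy1 G M) (h0 : ∀ t, 0 ≤ G t)
    (hy : G y = f y) (hn : G (n y) = f (n y)) :
    nodeSlope n f y ^ 2 ≤ 16 * M * f y := by
  have hM : 0 ≤ M := (abs_nonneg _).trans (hG.2 0).1
  have hf : 0 ≤ f y := hy ▸ h0 y
  unfold nodeSlope
  split_ifs with h
  swap
  · rw [zero_pow two_ne_zero]; positivity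
  by_cases hne : n y = y
  · simp [hne]; positivity
  have hd : 0 < |n y - y| := abs_pos.2 (sub_ne_zero.2 hne)
  have ht := hG.abs_sub_taylor_le y (n y)
  rw [hn, hy] at ht
  have hs := hG.sq_deriv_le h0 y
  rw [hy, ← sq_abs] at hs
  set s := (f (n y) - f y) / (n y - y) with hsdef
  have hsd : f (n y) - f y = s * (n y - y) := by
    rw [hsdef, div_mul_cancel₀ _ (sub_ne_zero.2 hne)]
  rw [hsd, abs_mul] at h
  rw [hsd, ← sub_mul, abs_mul, ← sq_abs (n y - y), sq, ← mul_assoc] at ht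
  have h₁ : |s - deriv G y| ≤ M * |n y - y| := le_of_mul_le_mul_right ht hd
  have h₂ : |s| ≤ |deriv G y| + M * |n y - y| := by
    have := abs_sub_abs_le_abs_sub s (deriv G y)
    linarith
  rw [← sq_abs s]
  rcases le_total (|deriv G y|) (M * |n y - y|) with hc | hc
  · have : |s| * |s| ≤ 2 * (M * |n y - y|) * |s| :=
      mul_le_mul_of_nonneg_right (by linarith) (abs_nonneg s)
    nlinarith [mul_le_mul_of_nonneg_left h hM, mul_nonneg hM hf]
  · nlinarith [abs_nonneg s, abs_nonneg (deriv G y)]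

theorem C2BddBy1.abs_nodeSlope_le (hG : C2BddBy1 G M) (h0 : ∀ t, 0 ≤ G t)
    (hy : G y = f y) (hn : G (n y) = f (n y)) : |nodeSlope n f y| ≤ 4 * M := by
  have hM : 0 ≤ M := (abs_nonneg _).trans (hG.2 0).1
  have hfM : f y ≤ M := hy ▸ (le_abs_self _).trans (hG.2 y).1
  refine abs_le_of_sq_le_sq ((hG.sq_nodeSlope_le h0 hy hn).trans ?_) (by positivity)
  nlinarith

theorem C2BddBy1.nodeCurv_mem (hG : C2BddBy1 G M) (h0 : ∀ t, 0 ≤ G t)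
    (hy : G y = f y) (hn : G (n y) = f (n y)) : 0 ≤ nodeCurv n f y ∧ nodeCurv n f y ≤ 4 * M := by
  have hM : 0 ≤ M := (abs_nonneg _).trans (hG.2 0).1
  have hf : 0 ≤ f y := hy ▸ h0 y
  refine ⟨by unfold nodeCurv; positivity, ?_⟩
  refine div_le_of_le_mul₀ (by positivity) (by positivity) ?_
  linarith [hG.sq_nodeSlope_le h0 hy hn]

theorem C2BddBy1.abs_nodePoly_le (hG : C2BddBy1 G M) (h0 : ∀ t, 0 ≤ G t)
    (hy : G y = f y) (hn : G (n y) = f (n y)) (ht : |t - y| ≤ 1) :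
    |nodePoly n f y t| ≤ 9 * M ∧ |nodePolyDeriv n f y t| ≤ 12 * M ∧
      |2 * nodeCurv n f y| ≤ 8 * M := by
  have hM : 0 ≤ M := (abs_nonneg _).trans (hG.2 0).1
  have hf : |f y| ≤ M := hy ▸ (hG.2 y).1
  have hm := hG.abs_nodeSlope_le h0 hy hn
  obtain ⟨q0, q1⟩ := hG.nodeCurv_mem h0 hy hn
  have hq : |nodeCurv n f y| ≤ 4 * M := by rwa [abs_of_nonneg q0]
  have e₁ : |nodeSlope n f y * (t - y)| ≤ 4 * M := by
    rw [abs_mul]; nlinarith [abs_nonneg (t - y)]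
  have e₂ : |nodeCurv n f y * (t - y)| ≤ 4 * M := by
    rw [abs_mul]; nlinarith [abs_nonneg (t - y)]
  have e₃ : |nodeCurv n f y * (t - y) ^ 2| ≤ 4 * M := by
    rw [sq, ← mul_assoc, abs_mul]; nlinarith [abs_nonneg (t - y)]
  unfold nodePoly nodePolyDeriv
  rw [abs_le] at hf hm hq e₁ e₂ e₃
  refine ⟨abs_le.2 ?_, abs_le.2 ?_, abs_le.2 ?_⟩ <;> constructor <;> linarith

theorem C2BddBy1.abs_nodePoly_sub_le {a b : ℝ} (hG : C2BddBy1 G M) (h0 : ∀ t, 0 ≤ G t)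
    (hab : a < b) (hat : a ≤ t) (htb : t ≤ b)
    (ha : G a = f a) (hna : G (n a) = f (n a)) (hne : n a ≠ a) (hda : |n a - a| ≤ b - a)
    (hb : G b = f b) (hnb : G (n b) = f (n b)) (hnb' : n b ≠ b) (hdb : |n b - b| ≤ b - a) :
    |nodePoly n f b t - nodePoly n f a t| ≤ 25 * M * (b - a) ^ 2 ∧
      |nodePolyDeriv n f b t - nodePolyDeriv n f a t| ≤ 27 * M * (b - a) := by
  have hM : 0 ≤ M := (abs_nonneg _).trans (hG.2 0).1
  set δ := b - a with hδ
  have hδ0 : 0 < δ := sub_pos.2 hab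
  obtain ⟨qa0, qa1⟩ := hG.nodeCurv_mem h0 ha hna
  obtain ⟨qb0, qb1⟩ := hG.nodeCurv_mem h0 hb hnb
  have ea : |nodeSlope n f a - deriv G a| ≤ 5 * (M * δ) :=
    (hG.abs_nodeSlope_sub_le h0 ha hna hne).trans (by gcongr)
  have eb : |nodeSlope n f b - deriv G b| ≤ 5 * (M * δ) :=
    (hG.abs_nodeSlope_sub_le h0 hb hnb hnb').trans (by gcongr)
  have eg : |deriv G b - deriv G a| ≤ M * δ := by
    have := hG.abs_deriv_sub_le a b
    rwa [← hδ, abs_of_pos hδ0] at this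
  have et : |f b - f a - deriv G a * δ| ≤ M * δ ^ 2 := by
    have := hG.abs_sub_taylor_le a b
    rwa [ha, hb, ← hδ] at this
  have em : |nodeSlope n f b - nodeSlope n f a| ≤ 11 * (M * δ) := by
    rw [abs_le] at *; constructor <;> linarith
  have ua : |t - a| ≤ δ := by rw [abs_le]; constructor <;> linarith
  have ub : |t - b| ≤ δ := by rw [abs_le]; constructor <;> linarith
  have pa : |nodeCurv n f a * (t - a)| ≤ 4 * M * δ := by
    rw [abs_mul, abs_of_nonneg qa0]; gcongr
  have pb : |nodeCurv n f b * (t - b)| ≤ 4 * M * δ := by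
    rw [abs_mul, abs_of_nonneg qb0]; gcongr
  have pa' : |nodeCurv n f a * (t - a) ^ 2| ≤ 4 * M * δ ^ 2 := by
    rw [abs_mul, abs_of_nonneg qa0, abs_pow]; gcongr
  have pb' : |nodeCurv n f b * (t - b) ^ 2| ≤ 4 * M * δ ^ 2 := by
    rw [abs_mul, abs_of_nonneg qb0, abs_pow]; gcongr
  have r₁ : |(nodeSlope n f b - nodeSlope n f a) * (t - b)| ≤ 11 * M * δ ^ 2 := by
    rw [abs_mul]
    calc _ ≤ 11 * (M * δ) * δ := by gcongr
      _ = _ := by ring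
  have r₂ : |(nodeSlope n f a - deriv G a) * δ| ≤ 5 * M * δ ^ 2 := by
    rw [abs_mul, abs_of_pos hδ0]
    calc _ ≤ 5 * (M * δ) * δ := by gcongr
      _ = _ := by ring
  constructor
  · have : nodePoly n f b t - nodePoly n f a t = (f b - f a - deriv G a * δ)
        - (nodeSlope n f a - deriv G a) * δ + (nodeSlope n f b - nodeSlope n f a) * (t - b)
        + nodeCurv n f b * (t - b) ^ 2 - nodeCurv n f a * (t - a) ^ 2 := by
      unfold nodePoly; rw [hδ]; ring
    rw [this]
    rw [abs_le] at *
    constructor <;> linarith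
  · have : nodePolyDeriv n f b t - nodePolyDeriv n f a t = (nodeSlope n f b - nodeSlope n f a)
        + 2 * (nodeCurv n f b * (t - b)) - 2 * (nodeCurv n f a * (t - a)) := by
      unfold nodePolyDeriv; ring
    rw [this]
    rw [abs_le] at *
    constructor <;> linarith

end NodePolynomials

section Interpolant

variable (s₀ s₁ s₂ : ℝ → ℝ) (E : Finset ℝ) (L R n f : ℝ → ℝ) (t : ℝ)

/-- The interpolant, a sum of node polynomials weighted by cells. -/
noncomputable def interp₀ : ℝ :=
  ∑ y ∈ E, cell₀ s₀ (L y) y (R y) t * nodePoly n f y t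

/-- The first derivative of the interpolant. -/
noncomputable def interp₁ : ℝ :=
  ∑ y ∈ E, (cell₁ s₀ s₁ (L y) y (R y) t * nodePoly n f y t +
    cell₀ s₀ (L y) y (R y) t * nodePolyDeriv n f y t)

/-- The second derivative of the interpolant. -/
noncomputable def interp₂ : ℝ :=
  ∑ y ∈ E, (cell₂ s₀ s₁ s₂ (L y) y (R y) t * nodePoly n f y t +
    2 * (cell₁ s₀ s₁ (L y) y (R y) t * nodePolyDeriv n f y t) +
    cell₀ s₀ (L y) y (R y) t * (2 * nodeCurv n f y))

variable {s₀ s₁ s₂ E L R n f t} {K : ℝ}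

theorem IsStep.hasDerivAt_interp₀ (h : IsStep s₀ s₁ s₂ K) :
    HasDerivAt (interp₀ s₀ E L R n f) (interp₁ s₀ s₁ E L R n f t) t :=
  HasDerivAt.fun_sum fun _ _ => h.hasDerivAt_cell₀.mul hasDerivAt_nodePoly

theorem IsStep.hasDerivAt_interp₁ (h : IsStep s₀ s₁ s₂ K) :
    HasDerivAt (interp₁ s₀ s₁ E L R n f) (interp₂ s₀ s₁ s₂ E L R n f t) t := by
  refine HasDerivAt.fun_sum fun y _ => ?_
  refine ((h.hasDerivAt_cell₁.mul hasDerivAt_nodePoly).add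
    (h.hasDerivAt_cell₀.mul hasDerivAt_nodePolyDeriv)).congr_deriv ?_
  ring

theorem IsStep.continuous_interp₂ (h : IsStep s₀ s₁ s₂ K) :
    Continuous (interp₂ s₀ s₁ s₂ E L R n f) := by
  refine continuous_finsetSum _ fun y _ => ?_
  have c₀ : Continuous (cell₀ s₀ (L y) y (R y)) :=
    continuous_iff_continuousAt.2 fun u => h.hasDerivAt_cell₀.continuousAt
  have c₁ : Continuous (cell₁ s₀ s₁ (L y) y (R y)) :=
    continuous_iff_continuousAt.2 fun u => h.hasDerivAt_cell₁.continuousAt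
  have c₂ : Continuous (cell₂ s₀ s₁ s₂ (L y) y (R y)) := h.continuous_cell₂
  have p₀ : Continuous (nodePoly n f y) :=
    continuous_iff_continuousAt.2 fun u => hasDerivAt_nodePoly.continuousAt
  have p₁ : Continuous (nodePolyDeriv n f y) :=
    continuous_iff_continuousAt.2 fun u => hasDerivAt_nodePolyDeriv.continuousAt
  fun_prop

theorem IsStep.interp_eq_sum_of_subset (h : IsStep s₀ s₁ s₂ K) (hE : IsNeighbors E L R)
    {A : Finset ℝ} (hA : A ⊆ E) (hA' : activePoints E L R t ⊆ A) :
    interp₀ s₀ E L R n f t = interp₀ s₀ A L R n f t ∧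
    interp₁ s₀ s₁ E L R n f t = interp₁ s₀ s₁ A L R n f t ∧
    interp₂ s₀ s₁ s₂ E L R n f t = interp₂ s₀ s₁ s₂ A L R n f t := by
  have key : ∀ y ∈ E, y ∉ A → cell₀ s₀ (L y) y (R y) t = 0 ∧ cell₁ s₀ s₁ (L y) y (R y) t = 0 ∧
      cell₂ s₀ s₁ s₂ (L y) y (R y) t = 0 := fun y hy hyA =>
    h.cell_eq_zero (hE.left_lt y) (hE.lt_right y)
      fun hlr => hyA (hA' (mem_activePoints.2 ⟨hy, hlr⟩))
  refine ⟨(Finset.sum_subset hA fun y hy hyA => ?_).symm,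
    (Finset.sum_subset hA fun y hy hyA => ?_).symm,
    (Finset.sum_subset hA fun y hy hyA => ?_).symm⟩ <;>
  obtain ⟨e₀, e₁, e₂⟩ := key y hy hyA <;> simp [e₀, e₁, e₂]

theorem activePoints_subset : activePoints E L R t ⊆ E :=
  fun _ hy => (mem_activePoints.1 hy).1

theorem IsStep.interp_congr (h : IsStep s₀ s₁ s₂ K) (hE : IsNeighbors E L R) {g : ℝ → ℝ}
    (hfg : ∀ y ∈ activePoints E L R t, f y = g y ∧ f (n y) = g (n y)) :
    interp₀ s₀ E L R n f t = interp₀ s₀ E L R n g t ∧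
    interp₁ s₀ s₁ E L R n f t = interp₁ s₀ s₁ E L R n g t ∧
    interp₂ s₀ s₁ s₂ E L R n f t = interp₂ s₀ s₁ s₂ E L R n g t := by
  obtain ⟨f₀, f₁, f₂⟩ :=
    h.interp_eq_sum_of_subset hE activePoints_subset subset_rfl (n := n) (f := f) (t := t)
  obtain ⟨g₀, g₁, g₂⟩ :=
    h.interp_eq_sum_of_subset hE activePoints_subset subset_rfl (n := n) (f := g) (t := t)
  rw [f₀, f₁, f₂, g₀, g₁, g₂]
  refine ⟨Finset.sum_congr rfl fun y hy => ?_, Finset.sum_congr rfl fun y hy => ?_,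
    Finset.sum_congr rfl fun y hy => ?_⟩ <;>
  obtain ⟨h₁, h₂⟩ := hfg y hy <;>
  obtain ⟨e₁, e₂⟩ := nodeCurv_congr (n := n) h₁ h₂ <;>
  simp only [nodePoly, nodePolyDeriv, e₁, e₂, h₁]

theorem IsStep.interp₀_eq (h : IsStep s₀ s₁ s₂ K) (hE : IsNeighbors E L R) (ht : t ∈ E) :
    interp₀ s₀ E L R n f t = f t := by
  have hsub : activePoints E L R t ⊆ {t} := fun y hy => by
    obtain ⟨hy, hl, hr⟩ := mem_activePoints.1 hy
    rw [Finset.mem_singleton]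
    rcases lt_trichotomy y t with hyt | hyt | hyt
    · linarith [hE.right_le_of_mem y t ht hyt]
    · exact hyt
    · linarith [hE.le_left_of_mem y t ht hyt]
  rw [(h.interp_eq_sum_of_subset hE (Finset.singleton_subset_iff.2 ht) hsub).1]
  simp [interp₀, (h.cell_self (hE.left_lt t) (hE.lt_right t)).1, nodePoly]

theorem IsStep.interp₀_nonneg (h : IsStep s₀ s₁ s₂ K) (hf : ∀ y ∈ E, 0 ≤ f y) :
    0 ≤ interp₀ s₀ E L R n f t :=
  Finset.sum_nonneg fun y hy => mul_nonneg h.cell₀_nonneg (nodePoly_nonneg (hf y hy))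

theorem IsStep.hasCompactSupport_interp₀ (h : IsStep s₀ s₁ s₂ K) (hE : IsNeighbors E L R) :
    HasCompactSupport (interp₀ s₀ E L R n f) := by
  refine HasCompactSupport.intro (K := ⋃ y ∈ E, Set.Icc (y - 1) (y + 1))
    (E.isCompact_biUnion fun y _ => isCompact_Icc) fun t ht => ?_
  refine Finset.sum_eq_zero fun y hy => ?_
  rw [(h.cell_eq_zero (hE.left_lt y) (hE.lt_right y) fun hlr => ht ?_).1, zero_mul]
  exact Set.mem_biUnion hy ⟨by linarith [hE.le_left y], by linarith [hE.right_le y]⟩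

theorem IsStep.deriv_interp₀ (h : IsStep s₀ s₁ s₂ K) :
    deriv (interp₀ s₀ E L R n f) = interp₁ s₀ s₁ E L R n f :=
  funext fun _ => h.hasDerivAt_interp₀.deriv

theorem IsStep.deriv_interp₁ (h : IsStep s₀ s₁ s₂ K) :
    deriv (interp₁ s₀ s₁ E L R n f) = interp₂ s₀ s₁ s₂ E L R n f :=
  funext fun _ => h.hasDerivAt_interp₁.deriv

theorem IsStep.contDiff_interp₀ (h : IsStep s₀ s₁ s₂ K) :
    ContDiff ℝ 2 (interp₀ s₀ E L R n f) :=
  contDiff_two_of_hasDerivAt (fun _ => h.hasDerivAt_interp₀) (fun _ => h.hasDerivAt_interp₁)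
    h.continuous_interp₂

theorem IsStep.exists_c2BddBy1_interp₀ (h : IsStep s₀ s₁ s₂ K) (hE : IsNeighbors E L R) :
    ∃ M, C2BddBy1 (interp₀ s₀ E L R n f) M := by
  have c₀ := h.hasCompactSupport_interp₀ hE (n := n) (f := f)
  have c₁ := c₀.deriv
  have c₂ := c₁.deriv
  have k₀ : Continuous (interp₀ s₀ E L R n f) := h.contDiff_interp₀.continuous
  have k₁ : Continuous (interp₁ s₀ s₁ E L R n f) :=
    continuous_iff_continuousAt.2 fun u => h.hasDerivAt_interp₁.continuousAt
  rw [h.deriv_interp₀] at c₁ c₂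
  rw [h.deriv_interp₁] at c₂
  obtain ⟨M₀, h₀⟩ := k₀.bounded_above_of_compact_support c₀
  obtain ⟨M₁, h₁⟩ := k₁.bounded_above_of_compact_support c₁
  obtain ⟨M₂, h₂⟩ := h.continuous_interp₂.bounded_above_of_compact_support c₂
  refine ⟨max M₀ (max M₁ M₂), h.contDiff_interp₀, fun t => ?_⟩
  rw [h.deriv_interp₀, h.deriv_interp₁]
  exact ⟨(h₀ t).trans (by simp), (h₁ t).trans (by simp), (h₂ t).trans (by simp)⟩

theorem abs_sum_le_two_mul {A : Finset ℝ} {g : ℝ → ℝ} {B : ℝ} (hB : 0 ≤ B) (hA : A.card ≤ 2)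
    (hg : ∀ y ∈ A, |g y| ≤ B) : |∑ y ∈ A, g y| ≤ 2 * B :=
  calc |∑ y ∈ A, g y| ≤ ∑ y ∈ A, |g y| := Finset.abs_sum_le_sum_abs _ _
    _ ≤ A.card • B := Finset.sum_le_card_nsmul _ _ _ hg
    _ = (A.card : ℝ) * B := nsmul_eq_mul _ _
    _ ≤ 2 * B := by gcongr; exact_mod_cast hA

theorem abs_convex_comb_le {w p q c : ℝ} (hw₀ : 0 ≤ w) (hw₁ : w ≤ 1) (hp : |p| ≤ c)
    (hq : |q| ≤ c) : |(1 - w) * p + w * q| ≤ c := by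
  rw [abs_le] at *
  constructor <;> nlinarith

theorem abs_div_mul_le {s d p B : ℝ} (hd : 0 < d) (hs : |s| ≤ K) (hp : |p| ≤ B * d) :
    |s / d * p| ≤ K * B := by
  have hK : 0 ≤ K := (abs_nonneg s).trans hs
  rw [abs_mul, abs_div, abs_of_pos hd]
  calc |s| / d * |p| ≤ K / d * (B * d) := by gcongr
    _ = K * B := by field_simp

variable {G : ℝ → ℝ} {M : ℝ}

theorem IsStep.abs_interp_le_of_not_pair (h : IsStep s₀ s₁ s₂ K) (hE : IsNeighbors E L R)
    (hn : IsNearest E n) (hG : C2BddBy1 G M) (h0 : ∀ t, 0 ≤ G t) (hGf : ∀ y ∈ E, G y = f y)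
    (hp : ¬ ∃ a ∈ E, ∃ b ∈ E, a < t ∧ t < b ∧ R a = b ∧ L b = a) :
    |interp₀ s₀ E L R n f t| ≤ 100 * K * M ∧ |interp₁ s₀ s₁ E L R n f t| ≤ 100 * K * M ∧
      |interp₂ s₀ s₁ s₂ E L R n f t| ≤ 100 * K * M := by
  have hM : 0 ≤ M := (abs_nonneg _).trans (hG.2 0).1
  have hK : 0 ≤ K := zero_le_one.trans h.one_le
  have hKM : 0 ≤ K * M := by positivity
  obtain ⟨f₀, f₁, f₂⟩ :=
    h.interp_eq_sum_of_subset hE activePoints_subset subset_rfl (n := n) (f := f) (t := t)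
  have key : ∀ y ∈ activePoints E L R t,
      |cell₀ s₀ (L y) y (R y) t * nodePoly n f y t| ≤ 9 * (K * M) ∧
      |cell₁ s₀ s₁ (L y) y (R y) t * nodePoly n f y t| ≤ 9 * (K * M) ∧
      |cell₂ s₀ s₁ s₂ (L y) y (R y) t * nodePoly n f y t| ≤ 9 * (K * M) ∧
      |cell₀ s₀ (L y) y (R y) t * nodePolyDeriv n f y t| ≤ 12 * (K * M) ∧
      |cell₁ s₀ s₁ (L y) y (R y) t * nodePolyDeriv n f y t| ≤ 12 * (K * M) ∧
      |cell₀ s₀ (L y) y (R y) t * (2 * nodeCurv n f y)| ≤ 8 * (K * M) := by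
    intro y hy
    obtain ⟨k₀, k₁, k₂⟩ := h.abs_cell_le hE hp hy
    obtain ⟨hyE, hl, hr⟩ := mem_activePoints.1 hy
    have hty : |t - y| ≤ 1 := by
      rw [abs_le]; constructor <;> linarith [hE.le_left y, hE.right_le y]
    obtain ⟨p₀, p₁, p₂⟩ := hG.abs_nodePoly_le h0 (hGf y hyE) (hGf _ (hn y hyE).1) hty
    have mul : ∀ {u v c : ℝ}, |u| ≤ K → |v| ≤ c * M → |u * v| ≤ c * (K * M) :=
      fun {u v c} hu hv => by
        rw [abs_mul]
        calc |u| * |v| ≤ K * (c * M) := by gcongr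
          _ = _ := by ring
    exact ⟨mul k₀ p₀, mul k₁ p₀, mul k₂ p₀, mul k₀ p₁, mul k₁ p₁, mul k₀ p₂⟩
  have hc := hE.card_activePoints_le t
  have hB : 0 ≤ 50 * (K * M) := by positivity
  rw [f₀, f₁, f₂, show 100 * K * M = 2 * (50 * (K * M)) by ring]
  refine ⟨abs_sum_le_two_mul hB hc fun y hy => ?_, abs_sum_le_two_mul hB hc fun y hy => ?_,
    abs_sum_le_two_mul hB hc fun y hy => ?_⟩ <;>
  obtain ⟨k₁, k₂, k₃, k₄, k₅, k₆⟩ := key y hy <;> clear key <;>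
  simp only [abs_le] at * <;> constructor <;> linarith

theorem IsStep.abs_interp_le_of_pair (h : IsStep s₀ s₁ s₂ K) (hE : IsNeighbors E L R)
    (hn : IsNearest E n) (hG : C2BddBy1 G M) (h0 : ∀ t, 0 ≤ G t) (hGf : ∀ y ∈ E, G y = f y)
    {a b : ℝ} (ha : a ∈ E) (hb : b ∈ E) (hat : a < t) (htb : t < b) (hR : R a = b)
    (hL : L b = a) :
    |interp₀ s₀ E L R n f t| ≤ 100 * K * M ∧ |interp₁ s₀ s₁ E L R n f t| ≤ 100 * K * M ∧
      |interp₂ s₀ s₁ s₂ E L R n f t| ≤ 100 * K * M := by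
  have hM : 0 ≤ M := (abs_nonneg _).trans (hG.2 0).1
  have hK := h.one_le
  have hab : a < b := hat.trans htb
  have hδ : 0 < b - a := sub_pos.2 hab
  have hδ1 : b - a ≤ 1 := by linarith [hE.right_le a]
  have hsub : ({a, b} : Finset ℝ) ⊆ E := by
    simp [Finset.insert_subset_iff, ha, hb]
  obtain ⟨f₀, f₁, f₂⟩ := h.interp_eq_sum_of_subset hE hsub
    (hE.activePoints_subset_pair ha hb hat htb hR) (n := n) (f := f) (t := t)
  obtain ⟨a₀, a₁, a₂⟩ := h.cell_of_ge (r := R a) (hE.left_lt a) hat.le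
  obtain ⟨b₀, b₁, b₂⟩ := h.cell_of_le (l := L b) (hE.lt_right b) htb.le
  have hu : (b - t) / (b - a) = 1 - (t - a) / (b - a) := by field_simp; ring
  rw [hR, hu, h.symm₀] at a₀
  rw [hR, hu, h.symm₁] at a₁
  rw [hR, hu, h.symm₂] at a₂
  rw [hL] at b₀ b₁ b₂
  set u := (t - a) / (b - a)
  obtain ⟨pa₀, pa₁, pa₂⟩ := hG.abs_nodePoly_le h0 (hGf a ha) (hGf _ (hn a ha).1)
    (show |t - a| ≤ 1 by rw [abs_le]; constructor <;> linarith)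
  obtain ⟨pb₀, pb₁, pb₂⟩ := hG.abs_nodePoly_le h0 (hGf b hb) (hGf _ (hn b hb).1)
    (show |t - b| ≤ 1 by rw [abs_le]; constructor <;> linarith)
  obtain ⟨na, da⟩ := (hn a ha).2 b hb hab.ne'
  obtain ⟨nb, db⟩ := (hn b hb).2 a ha hab.ne
  rw [abs_of_pos hδ] at da
  rw [abs_sub_comm a b, abs_of_pos hδ] at db
  obtain ⟨d₀, d₁⟩ := hG.abs_nodePoly_sub_le h0 hab hat.le htb.le (hGf a ha) (hGf _ (hn a ha).1)
    na da (hGf b hb) (hGf _ (hn b hb).1) nb db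
  have d₀' : |nodePoly n f b t - nodePoly n f a t| ≤ 25 * M * (b - a) :=
    d₀.trans (mul_le_mul_of_nonneg_left (pow_le_of_le_one hδ.le hδ1 two_ne_zero)
      (by positivity))
  have e₁ := abs_div_mul_le hδ (h.bound₁ u) d₀'
  have e₂ := abs_div_mul_le hδ (h.bound₁ u) d₁
  have e₃ := abs_div_mul_le (pow_pos hδ 2) (h.bound₂ u) d₀
  have m₀ := abs_convex_comb_le (h.nonneg u) (h.le_one u) pa₀ pb₀
  have m₁ := abs_convex_comb_le (h.nonneg u) (h.le_one u) pa₁ pb₁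
  have m₂ := abs_convex_comb_le (h.nonneg u) (h.le_one u) pa₂ pb₂
  have hKM : M ≤ K * M := le_mul_of_one_le_left hM hK
  have g₀ : interp₀ s₀ E L R n f t =
      (1 - s₀ u) * nodePoly n f a t + s₀ u * nodePoly n f b t := by
    rw [f₀, interp₀, Finset.sum_pair hab.ne, hR, hL, a₀, b₀]
  have g₁ : interp₁ s₀ s₁ E L R n f t =
      s₁ u / (b - a) * (nodePoly n f b t - nodePoly n f a t) +
        ((1 - s₀ u) * nodePolyDeriv n f a t + s₀ u * nodePolyDeriv n f b t) := by
    rw [f₁, interp₁, Finset.sum_pair hab.ne, hR, hL, a₀, b₀, a₁, b₁]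
    ring
  have g₂ : interp₂ s₀ s₁ s₂ E L R n f t =
      s₂ u / (b - a) ^ 2 * (nodePoly n f b t - nodePoly n f a t) +
        2 * (s₁ u / (b - a) * (nodePolyDeriv n f b t - nodePolyDeriv n f a t)) +
        ((1 - s₀ u) * (2 * nodeCurv n f a) + s₀ u * (2 * nodeCurv n f b)) := by
    rw [f₂, interp₂, Finset.sum_pair hab.ne, hR, hL, a₀, b₀, a₁, b₁, a₂, b₂]
    ring
  have hKM' : 0 ≤ K * M := hM.trans hKM
  rw [g₀, g₁, g₂]
  refine ⟨m₀.trans (by linarith only [hKM, hKM']), (abs_add_le _ _).trans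
    ((add_le_add e₁ m₁).trans (by linarith only [hKM, hKM'])), (abs_add_three _ _ _).trans ?_⟩
  rw [abs_mul 2, abs_two]
  linarith only [e₂, e₃, m₂, hKM, hKM']

theorem IsStep.abs_interp_le (h : IsStep s₀ s₁ s₂ K) (hE : IsNeighbors E L R)
    (hn : IsNearest E n) (hG : C2BddBy1 G M) (h0 : ∀ t, 0 ≤ G t) (hGf : ∀ y ∈ E, G y = f y) :
    |interp₀ s₀ E L R n f t| ≤ 100 * K * M ∧ |interp₁ s₀ s₁ E L R n f t| ≤ 100 * K * M ∧
      |interp₂ s₀ s₁ s₂ E L R n f t| ≤ 100 * K * M := by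
  by_cases hp : ∃ a ∈ E, ∃ b ∈ E, a < t ∧ t < b ∧ R a = b ∧ L b = a
  · obtain ⟨a, ha, b, hb, hat, htb, hR, hL⟩ := hp
    exact h.abs_interp_le_of_pair hE hn hG h0 hGf ha hb hat htb hR hL
  · exact h.abs_interp_le_of_not_pair hE hn hG h0 hGf hp

end Interpolant

theorem le_mul_posTraceNorm1 {E : Set ℝ} {f : ℝ → ℝ} {B C : ℝ} (hC : 0 < C)
    (hne : ∃ F M, (∀ t, 0 ≤ F t) ∧ (∀ t ∈ E, F t = f t) ∧ C2BddBy1 F M)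
    (h : ∀ F M, (∀ t, 0 ≤ F t) → (∀ t ∈ E, F t = f t) → C2BddBy1 F M → B ≤ C * M) :
    B ≤ C * posTraceNorm1 E f := by
  rw [← div_le_iff₀' hC]
  refine le_csInf ?_ ?_
  · obtain ⟨F, M, h₀, h₁, h₂⟩ := hne
    exact ⟨M, (abs_nonneg _).trans (h₂.2 0).1, F, h₀, h₁, h₂⟩
  · rintro M ⟨-, F, h₀, h₁, h₂⟩
    rw [div_le_iff₀' hC]
    exact h F M h₀ h₁ h₂

/-- One-dimensional bounded-depth nonnegative `C²`
interpolation: jet maps `Ξ₊ᵗ` (a two-jet is encoded as the triple of the value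
and the first two derivatives) realized by a single nonnegative interpolant. -/
theorem statement16 :
    ∃ (C : ℝ) (D₀ : ℕ), 0 < C ∧
      ∀ E₀ : Set ℝ, E₀.Finite →
        ∃ Ξ : ℝ → (ℝ → ℝ) → ℝ × ℝ × ℝ,
          (∀ t : ℝ, ∃ S : Set ℝ, S ⊆ E₀ ∧ S.ncard ≤ D₀ ∧
            ∀ f g : ℝ → ℝ, (∀ s ∈ E₀, 0 ≤ f s) → (∀ s ∈ E₀, 0 ≤ g s) →
              Set.EqOn f g S → Ξ t f = Ξ t g) ∧
          (∀ f : ℝ → ℝ, (∀ s ∈ E₀, 0 ≤ f s) →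
            ∃ F : ℝ → ℝ, ContDiff ℝ 2 F ∧ (∀ s, 0 ≤ F s) ∧
              (∀ t : ℝ, F t = (Ξ t f).1 ∧ deriv F t = (Ξ t f).2.1 ∧
                deriv (deriv F) t = (Ξ t f).2.2) ∧
              (∀ t : ℝ, |F t| ≤ C * posTraceNorm1 E₀ f ∧
                |deriv F t| ≤ C * posTraceNorm1 E₀ f ∧
                |deriv (deriv F) t| ≤ C * posTraceNorm1 E₀ f) ∧
              (∀ t ∈ E₀, F t = f t)) := by
  obtain ⟨s₀, s₁, s₂, K, h⟩ := exists_isStep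
  have hC : 0 < 100 * K := by linarith [h.one_le]
  refine ⟨100 * K, 4, hC, fun E₀ hE₀ => ?_⟩
  obtain ⟨E, rfl⟩ := hE₀.exists_finset_coe
  obtain ⟨L, R, hE⟩ := exists_isNeighbors E
  obtain ⟨n, hn⟩ := exists_isNearest E
  refine ⟨fun t f => (interp₀ s₀ E L R n f t, interp₁ s₀ s₁ E L R n f t,
    interp₂ s₀ s₁ s₂ E L R n f t), fun t => ?_, fun f hf => ?_⟩
  · classical
    refine ⟨↑(activePoints E L R t ∪ (activePoints E L R t).image n), ?_, ?_, ?_⟩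
    · rw [Finset.coe_subset]
      refine Finset.union_subset activePoints_subset (Finset.image_subset_iff.2 fun y hy => ?_)
      exact (hn y (activePoints_subset hy)).1
    · rw [Set.ncard_coe_finset]
      have h₁ := hE.card_activePoints_le t
      have h₂ := (Finset.card_image_le (s := activePoints E L R t) (f := n)).trans h₁
      exact (Finset.card_union_le _ _).trans (by omega)
    · intro f g _ _ hfg
      obtain ⟨e₀, e₁, e₂⟩ := h.interp_congr (n := n) hE (f := f) (g := g) (t := t) fun y hy =>
        ⟨hfg (Finset.mem_coe.2 (Finset.mem_union_left _ hy)),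
          hfg (Finset.mem_coe.2 (Finset.mem_union_right _ (Finset.mem_image_of_mem n hy)))⟩
      simp only [e₀, e₁, e₂]
  · have hval : ∀ t ∈ (E : Set ℝ), interp₀ s₀ E L R n f t = f t := fun t ht => h.interp₀_eq hE ht
    have hpos : ∀ t, 0 ≤ interp₀ s₀ E L R n f t := fun t => h.interp₀_nonneg hf
    obtain ⟨M, hM⟩ := h.exists_c2BddBy1_interp₀ hE (n := n) (f := f)
    refine ⟨interp₀ s₀ E L R n f, h.contDiff_interp₀, hpos, fun t => ?_, fun t => ?_, hval⟩
    · rw [h.deriv_interp₀, h.deriv_interp₁]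
      exact ⟨rfl, rfl, rfl⟩
    · rw [h.deriv_interp₀, h.deriv_interp₁]
      refine ⟨le_mul_posTraceNorm1 hC ⟨_, M, hpos, hval, hM⟩ fun G N h₀ h₁ h₂ => ?_,
        le_mul_posTraceNorm1 hC ⟨_, M, hpos, hval, hM⟩ fun G N h₀ h₁ h₂ => ?_,
        le_mul_posTraceNorm1 hC ⟨_, M, hpos, hval, hM⟩ fun G N h₀ h₁ h₂ => ?_⟩
      · exact (h.abs_interp_le hE hn h₂ h₀ h₁).1
      · exact (h.abs_interp_le hE hn h₂ h₀ h₁).2.1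
      · exact (h.abs_interp_le hE hn h₂ h₀ h₁).2.2
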